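/- arXiv:1701.05591 — 2 statements merged into one kernel-verified Lean document; each statement's English description precedes it below -/
import Mathlib

section
/- Let n be an odd integer with n > 3, and let c₁ be the minimum of f(n,p) taken over all primes p with 3 ≤ p ≤ ⌈√n⌉ (equivalently, the smallest odd composite exceeding n). Then n + 2 is the lower member of a pair of twin primes (i.e., both n + 2 and n + 4 are prime) if and only if c₁ − n = 6. -/
/-- `f n x = n + 2x - ((n - x) mod 2x)`, computed in the integers, where
`%` is the Euclidean remainder (nonnegative for a positive modulus). -/
def f (n x : ℤ) : ℤ := n + 2 * x - (n - x) % (2 * x)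

theorem lt_f (n : ℤ) {x : ℤ} (hx : 0 < x) : n < f n x := by
  have := Int.emod_lt_of_pos (n - x) (by omega : 0 < 2 * x)
  unfold f
  omega

theorem f_eq_mul (n x : ℤ) : f n x = x * (2 * ((n - x) / (2 * x)) + 3) := by
  have := Int.emod_add_mul_ediv (n - x) (2 * x)
  unfold f
  linear_combination -this

theorem f_le {n x k : ℤ} (hx : 0 < x) (hk : Odd k) (h : n < x * k) : f n x ≤ x * k := by
  have h₁ := Int.emod_nonneg (n - x) (by omega : 2 * x ≠ 0)
  have h₂ := f_eq_mul n x
  have h₃ : f n x = n + 2 * x - (n - x) % (2 * x) := rfl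
  obtain ⟨j, rfl⟩ := hk
  generalize (n - x) / (2 * x) = q at h₂
  have hj : q + 1 ≤ j := by
    by_contra! hlt
    have : x * (j + 1) ≤ x * (q + 1) := mul_le_mul_of_nonneg_left (by omega) hx.le
    linarith
  have : x * (q + 1) ≤ x * j := mul_le_mul_of_nonneg_left hj hx.le
  linarith

theorem f_le_of_dvd {n x m : ℤ} (hx : 0 < x) (hm : Odd m) (hd : x ∣ m) (h : n < m) :
    f n x ≤ m := by
  obtain ⟨k, rfl⟩ := hd
  exact f_le hx (Int.odd_mul.mp hm).2 h

theorem odd_of_prime_of_three_le {p : ℤ} (hp : Prime p) (h : 3 ≤ p) : Odd p := by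
  have hp' : (p.natAbs).Prime := Int.prime_iff_natAbs_prime.mp hp
  have := hp'.odd_of_ne_two (by omega)
  exact Int.natAbs_odd.mp this

theorem exists_prime_dvd_sq_le {m : ℤ} (hm : Odd m) (h : 1 < m) (hp : ¬ Prime m) :
    ∃ p : ℤ, Prime p ∧ 3 ≤ p ∧ p ∣ m ∧ p ^ 2 ≤ m := by
  lift m to ℕ using by omega
  have hm' : Odd m := by exact_mod_cast hm
  have hne : m ≠ 1 := by omega
  have hq : m.minFac.Prime := Nat.minFac_prime hne
  have hodd : Odd m.minFac := hm'.of_dvd_nat (Nat.minFac_dvd m)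
  refine ⟨m.minFac, Nat.prime_iff_prime_int.mp hq, ?_, ?_, ?_⟩
  · have := hq.two_le
    obtain ⟨t, ht⟩ := hodd
    omega
  · exact_mod_cast Nat.minFac_dvd m
  · exact_mod_cast Nat.minFac_sq_le_self (by omega)
      (fun hpm => hp (Nat.prime_iff_prime_int.mp hpm))

theorem le_ceil_sqrt {n p : ℤ} (hn : 3 < n) (hp : p ^ 2 ≤ n + 4) :
    p ≤ ⌈Real.sqrt (n : ℝ)⌉ := by
  have hn' : (4 : ℝ) ≤ n := by exact_mod_cast hn
  have hs : (2 : ℝ) ≤ Real.sqrt n := Real.le_sqrt_of_sq_le (by linarith)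
  have hsq : Real.sqrt n ^ 2 = n := Real.sq_sqrt (by linarith)
  have hp' : (p : ℝ) ^ 2 ≤ n + 4 := by exact_mod_cast hp
  have hlt : (p : ℝ) < Real.sqrt n + 1 := by nlinarith
  have hc := Int.le_ceil (Real.sqrt (n : ℝ))
  have : (p : ℝ) < (⌈Real.sqrt (n : ℝ)⌉ : ℝ) + 1 := by linarith
  exact Int.lt_add_one_iff.mp (by exact_mod_cast this)

theorem ceil_sqrt_le {n : ℤ} (hn : 0 < n) : ⌈Real.sqrt (n : ℝ)⌉ ≤ n := by
  have hn' : (1 : ℝ) ≤ n := by exact_mod_cast hn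
  exact Int.ceil_le.mpr (Real.sqrt_le_iff.mpr ⟨by linarith, by nlinarith⟩)

theorem not_dvd_of_prime_of_lt {p m : ℤ} (hm : Prime m) (hp : 1 < p) (h : p < m) :
    ¬ p ∣ m := by
  intro hd
  have hm' : (m.natAbs).Prime := Int.prime_iff_natAbs_prime.mp hm
  rcases (Nat.dvd_prime hm').mp (Int.natAbs_dvd_natAbs.mpr hd) with h' | h' <;> omega

/-- For odd `n > 3`, with `c₁` the minimum of `f n p` over primes
`p` with `3 ≤ p ≤ ⌈√n⌉`, the number `n + 2` is the lower member of a pair of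
twin primes iff `c₁ - n = 6`. -/
theorem twin_prime_test_gap (n : ℤ) (hnodd : Odd n) (hn : 3 < n) (c₁ : ℤ)
    (hc : IsLeast {m : ℤ | ∃ p : ℤ, Prime p ∧ 3 ≤ p ∧ p ≤ ⌈Real.sqrt (n : ℝ)⌉ ∧
        m = f n p} c₁) :
    (Prime (n + 2) ∧ Prime (n + 4)) ↔ c₁ - n = 6 := by
  have hnpos : 0 < n := by omega
  obtain ⟨⟨p, hp, hp3, hple, hpc⟩, hmin⟩ := hc
  have hpn : p ≤ n := hple.trans (ceil_sqrt_le hnpos)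
  have hdvd : p ∣ c₁ := hpc ▸ f_eq_mul n p ▸ dvd_mul_right _ _
  have hlt : n < c₁ := hpc ▸ lt_f n (by omega)
  have hodd : Odd c₁ := by
    rw [hpc, f_eq_mul]
    exact (odd_of_prime_of_three_le hp hp3).mul ⟨(n - p) / (2 * p) + 1, by ring⟩
  have hn2 : Odd (n + 2) := hnodd.add_even even_two
  have hn4 : Odd (n + 4) := hnodd.add_even (by decide)
  have hle {q m : ℤ} (hq : Prime q) (hq3 : 3 ≤ q) (hqs : q ^ 2 ≤ n + 4) (hm : Odd m)
      (hqm : q ∣ m) (hnm : n < m) : c₁ ≤ m :=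
    (hmin ⟨q, hq, hq3, le_ceil_sqrt hn hqs, rfl⟩).trans (f_le_of_dvd (by omega) hm hqm hnm)
  constructor
  · rintro ⟨h2, h4⟩
    have hne2 : c₁ ≠ n + 2 := fun h =>
      not_dvd_of_prime_of_lt h2 (by omega) (by omega) (h ▸ hdvd)
    have hne4 : c₁ ≠ n + 4 := fun h =>
      not_dvd_of_prime_of_lt h4 (by omega) (by omega) (h ▸ hdvd)
    have h32 := not_dvd_of_prime_of_lt h2 (by omega : (1 : ℤ) < 3) (by omega)
    have h34 := not_dvd_of_prime_of_lt h4 (by omega : (1 : ℤ) < 3) (by omega)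
    have hle6 : c₁ ≤ n + 6 :=
      hle Int.prime_three le_rfl (by obtain ⟨t, ht⟩ := hnodd; omega)
        (hnodd.add_even (by decide)) (by omega) (by omega)
    obtain ⟨t, ht⟩ := hnodd
    obtain ⟨u, hu⟩ := hodd
    omega
  · intro h
    constructor <;> by_contra hnp
    · obtain ⟨q, hq, hq3, hqd, hqs⟩ := exists_prime_dvd_sq_le hn2 (by omega) hnp
      have := hle hq hq3 (by omega) hn2 hqd (by omega)
      omega
    · obtain ⟨q, hq, hq3, hqd, hqs⟩ := exists_prime_dvd_sq_le hn4 (by omega) hnp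
      have := hle hq hq3 hqs hn4 hqd (by omega)
      omega
end

section
/- Let n be an odd integer with n ≥ 3. Then the number of odd primes x satisfying f(n − 2, x) = n equals ω(n), the number of distinct prime factors of n. -/
/-- For odd `n` and odd `x > 0`, the equation `f (n - 2) x = n` detects the divisors of `n`. -/
theorem f_sub_two_eq_iff_dvd {n x : ℤ} (hn : Odd n) (hx : Odd x) (hpos : 0 < x) :
    f (n - 2) x = n ↔ x ∣ n := by
  have hmod : (2 * x - 2) % (2 * x) = 2 * x - 2 :=
    Int.emod_eq_of_lt (by omega) (by omega)
  have hcop : IsCoprime (2 : ℤ) x := by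
    obtain ⟨k, rfl⟩ := hx
    exact ⟨-k, 1, by ring⟩
  calc f (n - 2) x = n
      ↔ (n - 2 - x) % (2 * x) = (2 * x - 2) % (2 * x) := by
        rw [hmod, f]
        constructor <;> intro h <;> linarith
    _ ↔ 2 * x ∣ n - x - 2 * x := by
        rw [Int.emod_eq_emod_iff_emod_sub_eq_zero, ← Int.dvd_iff_emod_eq_zero]
        ring_nf
    _ ↔ 2 * x ∣ n - x := dvd_sub_self_right
    _ ↔ x ∣ n - x :=
        ⟨dvd_of_mul_left_dvd, hcop.mul_dvd (hn.sub_odd hx).two_dvd⟩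
    _ ↔ x ∣ n := dvd_sub_self_right

/-- For an odd integer `n ≥ 3`, the number of (positive) odd
primes `x` with `f (n - 2) x = n` equals `ω n`, the number of distinct prime
factors of `n`. -/
theorem card_prime_solutions_eq_omega (n : ℤ) (hnodd : Odd n) (hn : 3 ≤ n) :
    {x : ℤ | 0 < x ∧ Odd x ∧ Prime x ∧ f (n - 2) x = n}.ncard =
      n.natAbs.primeFactors.card := by
  have himage : {x : ℤ | 0 < x ∧ Odd x ∧ Prime x ∧ f (n - 2) x = n} =
      (Nat.cast : ℕ → ℤ) '' (n.natAbs.primeFactors : Set ℕ) := by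
    ext x
    simp only [Set.mem_ofPred_eq, Set.mem_image, Finset.mem_coe, Nat.mem_primeFactors]
    constructor
    · rintro ⟨hpos, hodd, hprime, hf⟩
      exact ⟨x.natAbs, ⟨Int.prime_iff_natAbs_prime.mp hprime,
        Int.natAbs_dvd_natAbs.mpr ((f_sub_two_eq_iff_dvd hnodd hodd hpos).mp hf), by omega⟩,
        Int.natAbs_of_nonneg hpos.le⟩
    · rintro ⟨p, ⟨hp, hdvd, -⟩, rfl⟩
      have hpn : (p : ℤ) ∣ n := Int.natCast_dvd.mpr hdvd
      have hpos : (0 : ℤ) < p := by exact_mod_cast hp.pos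
      have hodd : Odd (p : ℤ) := by
        obtain ⟨c, rfl⟩ := hpn
        exact Int.Odd.of_mul_left hnodd
      exact ⟨hpos, hodd, Nat.prime_iff_prime_int.mp hp,
        (f_sub_two_eq_iff_dvd hnodd hodd hpos).mpr hpn⟩
  rw [himage, Set.ncard_image_of_injective _ Nat.cast_injective, Set.ncard_coe_finset]
end
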